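/- Characterization of optimal measurement sequences (Theorem 2): Let ρ and σ be density matrices on ℂ^k with σ positive definite. For each n, let E^n be a PVM on (ℂ^k)^{⊗n} commuting with both ρ^{⊗n} and σ^{⊗n} and satisfying w(E^n) ≤ (n+1)^{k−1}, and let M^n be a rank-one PVM on (ℂ^k)^{⊗n} refining E^n. Then B^{M⃗}(ρ‖σ) = D(ρ‖σ) holds if and only if the random variable −(1/n) log P_{σ^{⊗n}}^{M^n} converges to −Tr ρ log σ in probability with respect to P_{ρ^{⊗n}}^{M^n}, i.e., for every ε > 0, P_{ρ^{⊗n}}^{M^n}{ i : | −(1/n) log P_{σ^{⊗n}}^{M^n}(i) + Tr ρ log σ | > ε } → 0 as n → ∞. -/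

import Mathlib

open scoped BigOperators Classical ComplexOrder
open Matrix Filter

noncomputable def matFun {d : Type*} [Fintype d] [DecidableEq d] (f : ℝ → ℝ)
    (A : Matrix d d ℂ) : Matrix d d ℂ :=
  if hA : A.IsHermitian then hA.cfc f else 0

noncomputable def matLog {d : Type*} [Fintype d] [DecidableEq d]
    (A : Matrix d d ℂ) : Matrix d d ℂ :=
  matFun Real.log A

noncomputable def tensPow {k : ℕ} (ρ : Matrix (Fin k) (Fin k) ℂ) (n : ℕ) :
    Matrix (Fin n → Fin k) (Fin n → Fin k) ℂ :=
  fun x y => ∏ i, ρ (x i) (y i)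

structure IsPVM {d ι : Type*} [Fintype d] [DecidableEq d] [Fintype ι]
    (E : ι → Matrix d d ℂ) : Prop where
  herm : ∀ i, (E i).IsHermitian
  idem : ∀ i, E i * E i = E i
  ne_zero : ∀ i, E i ≠ 0
  orth : ∀ i j, i ≠ j → E i * E j = 0
  sum_one : ∑ i, E i = 1

noncomputable def pvmWidth {d ι : Type*} [Fintype d] [DecidableEq d] [Fintype ι]
    (E : ι → Matrix d d ℂ) : ℕ :=
  Finset.univ.sup fun i => (E i).rank

def Refines {d ι κ : Type*} [Fintype d] [DecidableEq d] [Fintype ι] [Fintype κ]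
    (M : κ → Matrix d d ℂ) (E : ι → Matrix d d ℂ) : Prop :=
  ∃ f : κ → ι, ∀ i, E i = ∑ j ∈ Finset.univ.filter (fun j => f j = i), M j

def IsTest {d : Type*} [Fintype d] [DecidableEq d] (A : Matrix d d ℂ) : Prop :=
  A.PosSemidef ∧ (1 - A).PosSemidef

noncomputable def pinch {d ι : Type*} [Fintype d] [DecidableEq d] [Fintype ι]
    (E : ι → Matrix d d ℂ) (A : Matrix d d ℂ) : Matrix d d ℂ :=
  ∑ i, E i * A * E i

/-- Quantum relative entropy `D(ρ‖σ) = Tr ρ (log ρ - log σ)`. -/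
noncomputable def qRelEnt {d : Type*} [Fintype d] [DecidableEq d]
    (ρ σ : Matrix d d ℂ) : ℝ :=
  (Matrix.trace (ρ * (matLog ρ - matLog σ))).re

section Classical

variable {ι : ℕ → Type} [∀ n, Fintype (ι n)]

theorem sum_filter_le_add_of_imp_or {α : Type*} [Fintype α] {P : α → ℝ} (hP : ∀ j, 0 ≤ P j)
    {c c₁ c₂ : α → Prop} [DecidablePred c] [DecidablePred c₁] [DecidablePred c₂]
    (h : ∀ j, c j → c₁ j ∨ c₂ j) :
    ∑ j ∈ Finset.univ.filter c, P j
      ≤ ∑ j ∈ Finset.univ.filter c₁, P j + ∑ j ∈ Finset.univ.filter c₂, P j := by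
  rw [Finset.sum_filter, Finset.sum_filter, Finset.sum_filter, ← Finset.sum_add_distrib]
  refine Finset.sum_le_sum fun j _ => ?_
  have := hP j
  have := h j
  split_ifs <;> first | linarith | tauto

theorem tendsto_exp_neg_nat_mul {ε : ℝ} (hε : 0 < ε) :
    Tendsto (fun n : ℕ => Real.exp (-(n * ε))) atTop (nhds 0) :=
  Real.tendsto_exp_neg_atTop_nhds_zero.comp
    (tendsto_natCast_atTop_atTop.atTop_mul_const hε)

/-- If the `P`-likelihood is at most `e^{n(h+ε)}` and the `Q`-likelihood at least `e^{n(m-ε)}`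
with high `P`-probability, no test with vanishing first-kind error can have a second-kind error
decaying faster than `e^{-n(h-m)}`. -/
theorem eventually_exp_le_sum_test {P Q : ∀ n, ι n → ℝ} {h m : ℝ}
    (hP : ∀ n j, 0 ≤ P n j) (hP1 : ∀ n, ∑ j, P n j = 1) (hQ : ∀ n j, 0 ≤ Q n j)
    (hPhi : ∀ ε > 0, Tendsto (fun n : ℕ =>
      ∑ j ∈ Finset.univ.filter (fun j => Real.exp (n * (h + ε)) ≤ P n j), P n j) atTop (nhds 0))
    (hQlo : ∀ ε > 0, Tendsto (fun n : ℕ =>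
      ∑ j ∈ Finset.univ.filter (fun j => Q n j ≤ Real.exp (n * (m - ε))), P n j) atTop (nhds 0))
    {T : ∀ n, ι n → ℝ} (hT : ∀ n j, T n j ∈ Set.Icc (0 : ℝ) 1)
    (hTP : Tendsto (fun n => ∑ j, (1 - T n j) * P n j) atTop (nhds 0)) {ε : ℝ} (hε : 0 < ε) :
    ∀ᶠ n : ℕ in atTop, Real.exp (-(n * (h - m + ε))) ≤ ∑ j, T n j * Q n j := by
  have hε3 : 0 < ε / 3 := by positivity
  have e1 := (hPhi _ hε3).eventually_lt_const (show (0 : ℝ) < 1 / 8 by norm_num)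
  have e2 := (hQlo _ hε3).eventually_lt_const (show (0 : ℝ) < 1 / 8 by norm_num)
  have e3 := hTP.eventually_lt_const (show (0 : ℝ) < 1 / 4 by norm_num)
  have e4 := (tendsto_exp_neg_nat_mul hε3).eventually_lt_const (show (0 : ℝ) < 1 / 2 by norm_num)
  filter_upwards [e1, e2, e3, e4] with n e1 e2 e3 e4
  have key : ∀ j, P n j ≤ (1 - T n j) * P n j
      + (if Real.exp (n * (h + ε / 3)) ≤ P n j then P n j else 0)
      + (if Q n j ≤ Real.exp (n * (m - ε / 3)) then P n j else 0)
      + Real.exp (n * (h - m + 2 * (ε / 3))) * (T n j * Q n j) := by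
    intro j
    obtain ⟨t0, t1⟩ := hT n j
    have p0 := hP n j
    have q0 := hQ n j
    have a1 : 0 ≤ (1 - T n j) * P n j := mul_nonneg (by linarith) p0
    have a2 : 0 ≤ Real.exp (n * (h - m + 2 * (ε / 3))) * (T n j * Q n j) := by positivity
    by_cases c1 : Real.exp (n * (h + ε / 3)) ≤ P n j
    · rw [if_pos c1]
      split_ifs <;> linarith
    by_cases c2 : Q n j ≤ Real.exp (n * (m - ε / 3))
    · rw [if_pos c2]
      split_ifs; linarith
    rw [if_neg c1, if_neg c2]
    have : P n j ≤ Real.exp (n * (h - m + 2 * (ε / 3))) * Q n j := by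
      calc P n j ≤ Real.exp (n * (h + ε / 3)) := (not_le.1 c1).le
        _ = Real.exp (n * (h - m + 2 * (ε / 3))) * Real.exp (n * (m - ε / 3)) := by
            rw [← Real.exp_add]; congr 1; ring
        _ ≤ _ := by gcongr; exact (not_le.1 c2).le
    nlinarith
  have hsum := Finset.sum_le_sum fun j (_ : j ∈ Finset.univ) => key j
  simp only [Finset.sum_add_distrib, ← Finset.sum_filter, ← Finset.mul_sum, hP1] at hsum
  have h2 : 1 / 2 ≤ Real.exp (n * (h - m + 2 * (ε / 3))) * ∑ j, T n j * Q n j := by linarith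
  have h3 : Real.exp (-(n * (h - m + ε)))
      = Real.exp (-(n * (ε / 3))) * Real.exp (-(n * (h - m + 2 * (ε / 3)))) := by
    rw [← Real.exp_add]; congr 1; ring
  rw [h3, Real.exp_neg (n * (h - m + 2 * (ε / 3)))]
  have hpos := Real.exp_pos (n * (h - m + 2 * (ε / 3)))
  rw [← div_eq_mul_inv, div_le_iff₀ hpos]
  linarith

/-- When `(1/n) log P` converges to `h` in `P`-probability and `(1/n) log Q` is asymptotically at
least `m`, the optimal exponent equals `h - m` iff `-(1/n) log Q` converges to `-m`. -/
theorem sSup_exponent_eq_iff_tendsto {P Q : ∀ n, ι n → ℝ} {h m : ℝ}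
    (hP : ∀ n j, 0 ≤ P n j) (hP1 : ∀ n, ∑ j, P n j = 1)
    (hQ : ∀ n j, 0 < Q n j) (hQ1 : ∀ n, ∑ j, Q n j = 1)
    (hPlo : ∀ ε > 0, Tendsto (fun n : ℕ =>
      ∑ j ∈ Finset.univ.filter (fun j => P n j ≤ Real.exp (n * (h - ε))), P n j) atTop (nhds 0))
    (hPhi : ∀ ε > 0, Tendsto (fun n : ℕ =>
      ∑ j ∈ Finset.univ.filter (fun j => Real.exp (n * (h + ε)) ≤ P n j), P n j) atTop (nhds 0))
    (hQlo : ∀ ε > 0, Tendsto (fun n : ℕ =>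
      ∑ j ∈ Finset.univ.filter (fun j => Q n j ≤ Real.exp (n * (m - ε))), P n j)
        atTop (nhds 0)) :
    sSup {lam : ℝ | ∃ T : ∀ n : ℕ, ι n → ℝ,
        (∀ n i, T n i ∈ Set.Icc (0 : ℝ) 1) ∧
        Tendsto (fun n : ℕ => ∑ i, (1 - T n i) * P n i) atTop (nhds 0) ∧
        limsup (fun n : ℕ => (1 / (n : ℝ)) * Real.log (∑ i, T n i * Q n i)) atTop ≤ -lam}
      = h - m
    ↔ ∀ ε > (0 : ℝ), Tendsto
        (fun n : ℕ => ∑ i ∈ Finset.univ.filter (fun i : ι n =>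
            ε < |(-(1 / (n : ℝ)) * Real.log (Q n i)) - (-m)|), P n i) atTop (nhds 0) := by
  set S := {lam : ℝ | ∃ T : ∀ n : ℕ, ι n → ℝ,
        (∀ n i, T n i ∈ Set.Icc (0 : ℝ) 1) ∧
        Tendsto (fun n : ℕ => ∑ i, (1 - T n i) * P n i) atTop (nhds 0) ∧
        limsup (fun n : ℕ => (1 / (n : ℝ)) * Real.log (∑ i, T n i * Q n i)) atTop ≤ -lam} with hS
  have hQ0 : ∀ n j, 0 ≤ Q n j := fun n j => (hQ n j).le
  have hbdd : ∀ T : ∀ n : ℕ, ι n → ℝ, (∀ n i, T n i ∈ Set.Icc (0 : ℝ) 1) →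
      IsBoundedUnder (· ≤ ·) atTop
        (fun n : ℕ => (1 / (n : ℝ)) * Real.log (∑ i, T n i * Q n i)) := by
    intro T hT
    refine isBoundedUnder_of ⟨0, fun n => ?_⟩
    refine mul_nonpos_of_nonneg_of_nonpos (by positivity) (Real.log_nonpos ?_ ?_)
    · exact Finset.sum_nonneg fun i _ => mul_nonneg (hT n i).1 (hQ0 n i)
    · rw [← hQ1 n]
      exact Finset.sum_le_sum fun i _ => mul_le_of_le_one_left (hQ0 n i) (hT n i).2
  have hlow : ∀ T : ∀ n : ℕ, ι n → ℝ, (∀ n i, T n i ∈ Set.Icc (0 : ℝ) 1) →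
      Tendsto (fun n : ℕ => ∑ i, (1 - T n i) * P n i) atTop (nhds 0) → ∀ ε > 0,
      ∀ᶠ n : ℕ in atTop, -(h - m + ε) ≤ (1 / (n : ℝ)) * Real.log (∑ i, T n i * Q n i) := by
    intro T hT hTP ε hε
    filter_upwards [eventually_exp_le_sum_test hP hP1 hQ0 hPhi hQlo hT hTP hε,
      eventually_gt_atTop 0] with n hn hn0
    have hn0' : (0 : ℝ) < n := by exact_mod_cast hn0
    have := Real.log_le_log (Real.exp_pos _) hn
    rw [Real.log_exp] at this
    rw [one_div, inv_mul_eq_div, le_div_iff₀ hn0']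
    linarith
  have hub : ∀ lam ∈ S, lam ≤ h - m := by
    rintro lam ⟨T, hT, hTP, hlim⟩
    refine le_of_forall_pos_le_add fun ε hε => ?_
    have := le_limsup_of_frequently_le (hlow T hT hTP ε hε).frequently (hbdd T hT)
    linarith
  have hne : S.Nonempty := by
    refine ⟨0, fun _ _ => 1, fun _ _ => by simp, by simp, ?_⟩
    simp [hQ1]
  constructor
  · intro hsup ε hε
    set δ := ε / 4 with hδ
    have hδ0 : 0 < δ := by positivity
    obtain ⟨lam, ⟨T, hT, hTP, hlim⟩, hlam⟩ :=
      exists_lt_of_lt_csSup hne (show h - m - δ < sSup S by linarith)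
    have hev := eventually_lt_of_limsup_lt (lt_of_le_of_lt hlim (neg_lt_neg hlam)) (hbdd T hT)
    have hlim0 := ((hQlo ε hε).add ((hPhi δ hδ0).add
      (hTP.add (tendsto_exp_neg_nat_mul hδ0))))
    simp only [add_zero] at hlim0
    refine tendsto_of_tendsto_of_tendsto_of_le_of_le' tendsto_const_nhds hlim0
      (Eventually.of_forall fun n => Finset.sum_nonneg fun i _ => hP n i) ?_
    filter_upwards [hev, eventually_gt_atTop 0,
      eventually_exp_le_sum_test hP hP1 hQ0 hPhi hQlo hT hTP hε] with n hn hn0 hpos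
    have hn0' : (0 : ℝ) < n := by exact_mod_cast hn0
    have hTQ : ∑ j, T n j * Q n j ≤ Real.exp (-(n * (h - m - δ))) := by
      rw [← Real.log_le_iff_le_exp (lt_of_lt_of_le (Real.exp_pos _) hpos)]
      rw [one_div, inv_mul_eq_div, div_lt_iff₀ hn0'] at hn
      linarith
    have key : ∀ j, (if ε < |(-(1 / (n : ℝ)) * Real.log (Q n j)) - (-m)| then P n j else 0) ≤
        (if Q n j ≤ Real.exp (n * (m - ε)) then P n j else 0)
        + ((if Real.exp (n * (h + δ)) ≤ P n j then P n j else 0)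
        + ((1 - T n j) * P n j + Real.exp (n * (h - m - 2 * δ)) * (T n j * Q n j))) := by
      intro j
      obtain ⟨t0, t1⟩ := hT n j
      have p0 := hP n j
      have q0 := hQ0 n j
      have a1 : 0 ≤ (1 - T n j) * P n j := mul_nonneg (by linarith) p0
      have a2 : 0 ≤ Real.exp (n * (h - m - 2 * δ)) * (T n j * Q n j) := by positivity
      by_cases c1 : Real.exp (n * (h + δ)) ≤ P n j
      · rw [if_pos c1]
        split_ifs <;> linarith
      by_cases c2 : Q n j ≤ Real.exp (n * (m - ε))
      · rw [if_pos c2]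
        split_ifs <;> linarith
      rw [if_neg c1, if_neg c2]
      split_ifs with c
      · have hQbig : Real.exp (n * (m + ε)) ≤ Q n j := by
          rw [← Real.le_log_iff_exp_le (hQ n j)]
          rw [← Real.log_le_iff_le_exp (hQ n j), not_le] at c2
          rcases lt_abs.1 c with c | c
          · rw [neg_mul, one_div, inv_mul_eq_div, sub_neg_eq_add, ← sub_lt_iff_lt_add,
              lt_neg, div_lt_iff₀ hn0'] at c
            nlinarith
          · have : m + ε < Real.log (Q n j) / n := by
              rw [neg_mul, one_div, inv_mul_eq_div] at c; linarith
            rw [lt_div_iff₀ hn0'] at this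
            nlinarith
        have : P n j ≤ Real.exp (n * (h - m - 2 * δ)) * Q n j := by
          calc P n j ≤ Real.exp (n * (h + δ)) := (not_le.1 c1).le
            _ ≤ Real.exp (n * (h - m - 2 * δ)) * Real.exp (n * (m + ε)) := by
                rw [← Real.exp_add]
                refine Real.exp_le_exp.2 ?_
                rw [← mul_add]
                refine mul_le_mul_of_nonneg_left ?_ hn0'.le
                linarith
            _ ≤ _ := by gcongr
        nlinarith
      · linarith
    have hsum := Finset.sum_le_sum fun j (_ : j ∈ Finset.univ) => key j
    simp only [Finset.sum_add_distrib, ← Finset.sum_filter, ← Finset.mul_sum] at hsum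
    refine hsum.trans ?_
    gcongr
    calc _ ≤ Real.exp (n * (h - m - 2 * δ)) * Real.exp (-(n * (h - m - δ))) := by gcongr
      _ = _ := by rw [← Real.exp_add]; congr 1; ring
  · intro hconv
    refine le_antisymm (csSup_le hne hub) ?_
    refine le_of_forall_pos_le_add fun ε hε => ?_
    rw [← sub_le_iff_le_add]
    refine le_csSup ⟨_, hub⟩ ?_
    set δ := ε / 2 with hδ
    have hδ0 : 0 < δ := by positivity
    let T : ∀ n, ι n → ℝ := fun n j =>
      if Real.exp (n * (h - δ)) < P n j ∧ Q n j ≤ Real.exp (n * (m + δ)) then 1 else 0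
    have hT : ∀ n j, T n j ∈ Set.Icc (0 : ℝ) 1 := by
      intro n j
      simp only [T]
      split_ifs <;> simp
    have hTP : Tendsto (fun n : ℕ => ∑ i, (1 - T n i) * P n i) atTop (nhds 0) := by
      have hlim0 := (hPlo δ hδ0).add (hconv (δ / 2) (by positivity))
      simp only [add_zero] at hlim0
      refine tendsto_of_tendsto_of_tendsto_of_le_of_le' tendsto_const_nhds hlim0
        (Eventually.of_forall fun n => Finset.sum_nonneg fun i _ =>
          mul_nonneg (by linarith [(hT n i).2]) (hP n i)) ?_
      filter_upwards [eventually_gt_atTop 0] with n hn0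
      have hn0' : (0 : ℝ) < n := by exact_mod_cast hn0
      have : ∀ j, (1 - T n j) * P n j =
          if ¬ (Real.exp (n * (h - δ)) < P n j ∧ Q n j ≤ Real.exp (n * (m + δ)))
            then P n j else 0 := by
        intro j
        simp only [T]
        split_ifs <;> simp
      simp only [this]
      rw [← Finset.sum_filter]
      refine sum_filter_le_add_of_imp_or (hP n) fun j hj => ?_
      by_cases c1 : P n j ≤ Real.exp (n * (h - δ))
      · exact Or.inl c1
      right
      have c2 : Real.exp (n * (m + δ)) < Q n j := by
        by_contra c2
        exact hj ⟨not_le.1 c1, not_lt.1 c2⟩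
      rw [← Real.lt_log_iff_exp_lt (hQ n j), mul_comm, ← lt_div_iff₀ hn0'] at c2
      refine lt_abs.2 (Or.inr ?_)
      rw [neg_mul, one_div, inv_mul_eq_div]
      linarith
    refine ⟨T, hT, hTP, ?_⟩
    refine limsup_le_of_le ?_ ?_
    · exact IsBoundedUnder.isCoboundedUnder_le ⟨_, (hlow T hT hTP 1 one_pos)⟩
    · filter_upwards [eventually_exp_le_sum_test hP hP1 hQ0 hPhi hQlo hT hTP hε,
        eventually_gt_atTop 0] with n hpos hn0
      have hn0' : (0 : ℝ) < n := by exact_mod_cast hn0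
      have hle : ∑ j, T n j * Q n j ≤ Real.exp (-(n * (h - m - ε))) := by
        calc ∑ j, T n j * Q n j ≤ ∑ j, Real.exp (-(n * (h - m - ε))) * P n j := by
              refine Finset.sum_le_sum fun j _ => ?_
              have p0 := hP n j
              simp only [T]
              split_ifs with c
              · rw [one_mul]
                calc Q n j ≤ Real.exp (n * (m + δ)) := c.2
                  _ = Real.exp (-(n * (h - m - ε))) * Real.exp (n * (h - δ)) := by
                    rw [← Real.exp_add]; congr 1; rw [hδ]; ring
                  _ ≤ _ := by gcongr; exact c.1.le
              · rw [zero_mul]; positivity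
          _ = _ := by rw [← Finset.mul_sum, hP1, mul_one]
      rw [← Real.log_le_iff_le_exp (lt_of_lt_of_le (Real.exp_pos _) hpos)] at hle
      rw [one_div, inv_mul_eq_div, div_le_iff₀ hn0']
      linarith

end Classical

section WeakLaw

variable {α : Type*} [Fintype α]

theorem sum_eq_sum_sum_cons (n : ℕ) (F : (Fin (n + 1) → α) → ℝ) :
    ∑ x, F x = ∑ a, ∑ x : Fin n → α, F (Fin.cons a x) := by
  rw [← (Fin.consEquiv fun _ => α).sum_comp, Fintype.sum_prod_type]
  rfl

theorem sum_prod_eq_one {p : α → ℝ} (hp1 : ∑ a, p a = 1) (n : ℕ) :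
    ∑ x : Fin n → α, ∏ i, p (x i) = 1 := by
  rw [← Fintype.prod_sum]
  simp [hp1]

theorem sum_prod_mul_sum_eq_zero {p g : α → ℝ} (hp1 : ∑ a, p a = 1) (hg : ∑ a, p a * g a = 0)
    (n : ℕ) : ∑ x : Fin n → α, (∏ i, p (x i)) * ∑ i, g (x i) = 0 := by
  induction n with
  | zero => simp
  | succ n ih =>
    rw [sum_eq_sum_sum_cons]
    simp only [Fin.prod_univ_succ, Fin.sum_univ_succ, Fin.cons_zero, Fin.cons_succ]
    have : ∀ a, ∑ x : Fin n → α, p a * (∏ i, p (x i)) * (g a + ∑ i, g (x i)) = p a * g a := by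
      intro a
      calc _ = p a * g a * ∑ x : Fin n → α, ∏ i, p (x i)
            + p a * ∑ x : Fin n → α, (∏ i, p (x i)) * ∑ i, g (x i) := by
            rw [Finset.mul_sum, Finset.mul_sum, ← Finset.sum_add_distrib]
            exact Finset.sum_congr rfl fun x _ => by ring
        _ = _ := by rw [ih, sum_prod_eq_one hp1]; ring
    simp only [this, hg]

theorem sum_prod_mul_sum_sq {p g : α → ℝ} (hp1 : ∑ a, p a = 1) (hg : ∑ a, p a * g a = 0)
    (n : ℕ) : ∑ x : Fin n → α, (∏ i, p (x i)) * (∑ i, g (x i)) ^ 2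
      = n * ∑ a, p a * g a ^ 2 := by
  induction n with
  | zero => simp
  | succ n ih =>
    rw [sum_eq_sum_sum_cons]
    simp only [Fin.prod_univ_succ, Fin.sum_univ_succ, Fin.cons_zero, Fin.cons_succ]
    have : ∀ a, ∑ x : Fin n → α, p a * (∏ i, p (x i)) * (g a + ∑ i, g (x i)) ^ 2
        = p a * g a ^ 2 + p a * (n * ∑ a, p a * g a ^ 2) := by
      intro a
      calc _ = p a * g a ^ 2 * ∑ x : Fin n → α, ∏ i, p (x i)
            + 2 * p a * g a * ∑ x : Fin n → α, (∏ i, p (x i)) * ∑ i, g (x i)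
            + p a * ∑ x : Fin n → α, (∏ i, p (x i)) * (∑ i, g (x i)) ^ 2 := by
            rw [Finset.mul_sum, Finset.mul_sum, Finset.mul_sum, ← Finset.sum_add_distrib,
              ← Finset.sum_add_distrib]
            exact Finset.sum_congr rfl fun x _ => by ring
        _ = _ := by rw [ih, sum_prod_eq_one hp1, sum_prod_mul_sum_eq_zero hp1 hg]; ring
    simp only [this, Finset.sum_add_distrib, ← Finset.sum_mul, hp1]
    push_cast
    ring

/-- Weak law of large numbers for finitely supported i.i.d. variables. -/
theorem tendsto_sum_prod_filter_deviation {p : α → ℝ} (hp : ∀ a, 0 ≤ p a) (hp1 : ∑ a, p a = 1)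
    (g : α → ℝ) {ε : ℝ} (hε : 0 < ε) :
    Tendsto (fun n : ℕ => ∑ x ∈ Finset.univ.filter (fun x : Fin n → α =>
      n * ε < |∑ i, g (x i) - n * ∑ a, p a * g a|), ∏ i, p (x i)) atTop (nhds 0) := by
  set m := ∑ a, p a * g a with hm
  set v := ∑ a, p a * (g a - m) ^ 2
  have hlim : Tendsto (fun n : ℕ => v / ε ^ 2 / (n : ℝ)) atTop (nhds 0) :=
    tendsto_const_div_atTop_nhds_zero_nat _
  refine tendsto_of_tendsto_of_tendsto_of_le_of_le' tendsto_const_nhds hlim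
    (Eventually.of_forall fun n => Finset.sum_nonneg fun x _ =>
      Finset.prod_nonneg fun i _ => hp _) ?_
  filter_upwards [eventually_gt_atTop 0] with n hn0
  have hn : (0 : ℝ) < n := by exact_mod_cast hn0
  have hmean : ∑ a, p a * (g a - m) = 0 := by
    simp only [mul_sub, Finset.sum_sub_distrib, ← Finset.sum_mul, hp1]
    rw [← hm]; ring
  have hvar := sum_prod_mul_sum_sq hp1 hmean n
  have hle : ∑ x ∈ Finset.univ.filter (fun x : Fin n → α =>
      n * ε < |∑ i, g (x i) - n * m|), ∏ i, p (x i)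
      ≤ ∑ x : Fin n → α, ((n * ε) ^ 2)⁻¹ *
        ((∏ i, p (x i)) * (∑ i, (g (x i) - m)) ^ 2) := by
    rw [Finset.sum_filter]
    refine Finset.sum_le_sum fun x _ => ?_
    have hpx : 0 ≤ ∏ i, p (x i) := Finset.prod_nonneg fun i _ => hp _
    split_ifs with c
    · simp only [Finset.sum_sub_distrib, Finset.sum_const, Finset.card_univ, Fintype.card_fin,
        nsmul_eq_mul]
      have h1 : (n * ε) ^ 2 ≤ (∑ i, g (x i) - n * m) ^ 2 := by
        rw [← sq_abs (∑ i, g (x i) - n * m)]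
        gcongr
      rw [inv_mul_eq_div, le_div_iff₀ (by positivity)]
      exact mul_le_mul_of_nonneg_left h1 hpx
    · positivity
  refine hle.trans (le_of_eq ?_)
  rw [← Finset.mul_sum, hvar]
  change _ * (n * v) = _
  field_simp

end WeakLaw

section Trace

variable {d ι κ : Type*} [Fintype d]

theorem trace_proj_mul_re_nonneg {M A : Matrix d d ℂ} (hM : M.IsHermitian)
    (hMM : M * M = M) (hA : A.PosSemidef) : 0 ≤ (trace (M * A)).re := by
  have h1 : trace (M * A) = trace (Mᴴ * A * M) := by
    rw [hM.eq, Matrix.mul_assoc, trace_mul_comm M (A * M), Matrix.mul_assoc, hMM,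
      trace_mul_comm]
  rw [h1]
  exact (Complex.le_def.1 (hA.conjTranspose_mul_mul_same M).trace_nonneg).1

variable [DecidableEq d] [Fintype κ]

theorem trace_eq_rank_of_idem {M : Matrix d d ℂ} (hMM : M * M = M) :
    trace M = (M.rank : ℂ) := by
  have hid : IsIdempotentElem (Matrix.toLin' M) := by
    rw [IsIdempotentElem, Module.End.mul_eq_comp, ← Matrix.toLin'_mul, hMM]
  have := (LinearMap.IsIdempotentElem.isProj_range _ hid).trace
  rw [Matrix.trace_toLin'_eq] at this
  rw [this]
  rfl

theorem IsPVM.trace_eq_one_of_width {M : κ → Matrix d d ℂ} (hM : IsPVM M)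
    (hw : pvmWidth M = 1) (j : κ) : trace (M j) = 1 := by
  have h1 : (M j).rank ≤ 1 := hw ▸ Finset.le_sup (f := fun i => (M i).rank) (Finset.mem_univ j)
  have h0 : (M j).rank ≠ 0 := fun h => hM.ne_zero j <| by
    rw [← trace_conjTranspose_mul_self_eq_zero_iff, (hM.herm j).eq, hM.idem,
      trace_eq_rank_of_idem (hM.idem j), h, Nat.cast_zero]
  rw [trace_eq_rank_of_idem (hM.idem j), show (M j).rank = 1 by omega, Nat.cast_one]

theorem IsPVM.sum_trace_mul_re {M : κ → Matrix d d ℂ} (hM : IsPVM M) (A : Matrix d d ℂ) :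
    ∑ j, (trace (M j * A)).re = (trace A).re := by
  rw [← Complex.re_sum, ← trace_sum, ← Finset.sum_mul, hM.sum_one, one_mul]

/-- If `A` has small expectation and `R - A` is bounded by `u`, outcomes with `R`-likelihood
at least `2u` are `R`-improbable. -/
theorem IsPVM.sum_filter_large_le {M : κ → Matrix d d ℂ} (hM : IsPVM M)
    (hw : pvmWidth M = 1) {R A : Matrix d d ℂ} {u : ℝ} (hA : A.PosSemidef)
    (hAu : ((u : ℂ) • 1 - (R - A)).PosSemidef) {J : Finset κ}
    (hJ : ∀ j ∈ J, 2 * u ≤ (trace (M j * R)).re) :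
    ∑ j ∈ J, (trace (M j * R)).re ≤ 2 * (trace A).re := by
  rw [← hM.sum_trace_mul_re A, Finset.mul_sum]
  have hnn : ∀ j, 0 ≤ (trace (M j * A)).re := fun j =>
    trace_proj_mul_re_nonneg (hM.herm j) (hM.idem j) hA
  refine le_trans (Finset.sum_le_sum fun j hj => ?_)
    (Finset.sum_le_sum_of_subset_of_nonneg (Finset.subset_univ J)
      fun j _ _ => mul_nonneg two_pos.le (hnn j))
  have h1 := trace_proj_mul_re_nonneg (hM.herm j) (hM.idem j) hAu
  simp only [Matrix.mul_sub, trace_sub, Matrix.mul_smul, trace_smul,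
    hM.trace_eq_one_of_width hw j, smul_eq_mul, mul_one, Complex.sub_re, Complex.ofReal_re] at h1
  have := hJ j hj
  linarith

theorem posSemidef_trace_smul_one_sub {R : Matrix d d ℂ} (hR : R.PosSemidef) :
    (((trace R).re : ℂ) • 1 - R).PosSemidef := by
  set U := (hR.1.eigenvectorUnitary : Matrix d d ℂ) with hU
  have hUU : U * Uᴴ = 1 := Unitary.coe_mul_star_self hR.1.eigenvectorUnitary
  have hspec : R = U * diagonal (fun i => (hR.1.eigenvalues i : ℂ)) * Uᴴ := by
    conv_lhs => rw [hR.1.spectral_theorem]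
    rfl
  have htr : (trace R).re = ∑ i, hR.1.eigenvalues i := by
    rw [hR.1.trace_eq_sum_eigenvalues]
    simp
  have : ((trace R).re : ℂ) • 1 - R
      = U * diagonal (fun i => (((trace R).re - hR.1.eigenvalues i : ℝ) : ℂ)) * Uᴴ := by
    have h2 : diagonal (fun i => (((trace R).re - hR.1.eigenvalues i : ℝ) : ℂ))
        = ((trace R).re : ℂ) • (1 : Matrix d d ℂ)
          - diagonal (fun i => (hR.1.eigenvalues i : ℂ)) := by
      ext i j
      by_cases h : i = j <;> simp [h]
    rw [h2, Matrix.mul_sub, Matrix.sub_mul, ← hspec, Matrix.mul_smul, Matrix.smul_mul,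
      Matrix.mul_one, hUU]
  rw [this]
  refine (PosSemidef.diagonal fun i => ?_).mul_mul_conjTranspose_same U
  simp only [Pi.zero_apply]
  rw [Complex.zero_le_real, sub_nonneg, htr]
  exact Finset.single_le_sum (fun i _ => hR.eigenvalues_nonneg i) (Finset.mem_univ i)

/-- `R ≤ 2 (ΠRΠ + (1-Π)R(1-Π))`, evaluated against a projection. -/
theorem trace_mul_re_le_two_mul_pinched {M Q R : Matrix d d ℂ} (hM : M.IsHermitian)
    (hMM : M * M = M) (hQ : Q.IsHermitian) (hR : R.PosSemidef) :
    (trace (M * R)).re ≤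
      2 * (trace (M * (Q * R * Q))).re + 2 * (trace (M * ((1 - Q) * R * (1 - Q)))).re := by
  have hH : (Q - (1 - Q))ᴴ = Q - (1 - Q) := by
    simp [conjTranspose_sub, hQ.eq]
  have h := trace_proj_mul_re_nonneg hM hMM
    (hR.conjTranspose_mul_mul_same (Q - (1 - Q)))
  rw [hH] at h
  have hid : M * R + M * ((Q - (1 - Q)) * R * (Q - (1 - Q)))
      = (M * (Q * R * Q) + M * (Q * R * Q))
        + (M * ((1 - Q) * R * (1 - Q)) + M * ((1 - Q) * R * (1 - Q))) := by
    noncomm_ring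
  have := congrArg (fun X => (trace X).re) hid
  simp only [trace_add, Complex.add_re] at this
  linarith

theorem IsPVM.mul_eq_of_refines {M : κ → Matrix d d ℂ} {E : ι → Matrix d d ℂ} (hM : IsPVM M)
    {f : κ → ι} (hf : ∀ i, E i = ∑ j ∈ Finset.univ.filter (fun j => f j = i), M j) (j : κ) :
    M j * E (f j) = M j ∧ E (f j) * M j = M j := by
  rw [hf (f j)]
  constructor
  · rw [Finset.mul_sum, Finset.sum_eq_single j, hM.idem]
    · exact fun l _ hl => hM.orth _ _ (Ne.symm hl)
    · intro h; simp at h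
  · rw [Finset.sum_mul, Finset.sum_eq_single j, hM.idem]
    · exact fun l _ hl => hM.orth _ _ hl
    · intro h; simp at h

/-- Outcomes of a rank-one refinement with small `S`-likelihood have small `R`-probability,
if `S ≥ t Q` for a projection `Q` carrying most of `R`. -/
theorem IsPVM.sum_filter_small_le [Fintype ι] {M : κ → Matrix d d ℂ}
    {E : ι → Matrix d d ℂ} (hM : IsPVM M) (hMw : pvmWidth M = 1) (hE : IsPVM E) (hRef : Refines M E)
    {R S Q : Matrix d d ℂ} {w : ℕ} (hEw : pvmWidth E ≤ w) (hER : ∀ i, E i * R = R * E i)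
    (hR : R.PosSemidef) (hR1 : trace R = 1) (hQ : Q.IsHermitian) (hQQ : Q * Q = Q)
    {t c : ℝ} (ht : 0 < t) (hc : 0 ≤ c) (hS : (S - (t : ℂ) • Q).PosSemidef) {J : Finset κ}
    (hJ : ∀ j ∈ J, (trace (M j * S)).re ≤ c) :
    ∑ j ∈ J, (trace (M j * R)).re ≤ 2 * (trace ((1 - Q) * R)).re + 2 * (w * (c / t)) := by
  obtain ⟨f, hf⟩ := hRef
  set B : ι → Matrix d d ℂ := fun i => E i * R * E i with hB
  have hBpos : ∀ i, (B i).PosSemidef := fun i => by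
    have := hR.conjTranspose_mul_mul_same (E i)
    rwa [(hE.herm i).eq] at this
  have hBeq : ∀ i, B i = E i * R := fun i => by
    simp only [hB]
    rw [Matrix.mul_assoc, ← hER, ← Matrix.mul_assoc, hE.idem]
  have hBsum : ∑ i, B i = R := by
    simp only [hBeq]
    rw [← Finset.sum_mul, hE.sum_one, one_mul]
  have hMB : ∀ j, trace (M j * R) = trace (M j * B (f j)) := fun j => by
    rw [hBeq, ← Matrix.mul_assoc, (hM.mul_eq_of_refines hf j).1]
  have hcard : ∀ i, ((Finset.univ.filter (fun j => f j = i)).card : ℝ) ≤ w := by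
    intro i
    have h1 : trace (E i) = ((Finset.univ.filter (fun j => f j = i)).card : ℂ) := by
      rw [hf i, trace_sum, Finset.sum_congr rfl fun j _ => hM.trace_eq_one_of_width hMw j]
      simp
    rw [trace_eq_rank_of_idem (hE.idem i)] at h1
    have h2 : (E i).rank = (Finset.univ.filter (fun j => f j = i)).card := by exact_mod_cast h1
    have h3 : (E i).rank ≤ w :=
      (Finset.le_sup (f := fun i => (E i).rank) (Finset.mem_univ i)).trans hEw
    rw [← h2]
    exact_mod_cast h3
  have hQ' : (1 - Q).IsHermitian := isHermitian_one.sub hQ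
  have hsecond : ∀ i j, 0 ≤ (trace (M j * ((1 - Q) * B i * (1 - Q)))).re := fun i j => by
    have := (hBpos i).conjTranspose_mul_mul_same (1 - Q)
    rw [hQ'.eq] at this
    exact trace_proj_mul_re_nonneg (hM.herm j) (hM.idem j) this
  have hBtr : ∀ i, 0 ≤ (trace (B i)).re := fun i =>
    (Complex.le_def.1 (hBpos i).trace_nonneg).1
  have hfirst : ∀ j ∈ J, (trace (M j * (Q * B (f j) * Q))).re ≤
      (trace (B (f j))).re * (c / t) := by
    intro j hj
    have h1 := (posSemidef_trace_smul_one_sub (hBpos (f j))).conjTranspose_mul_mul_same Q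
    rw [hQ.eq] at h1
    have h2 := trace_proj_mul_re_nonneg (hM.herm j) (hM.idem j) h1
    have h3 := trace_proj_mul_re_nonneg (hM.herm j) (hM.idem j) hS
    simp only [Matrix.mul_sub, Matrix.sub_mul, trace_sub, Matrix.mul_smul, Matrix.smul_mul,
      Matrix.mul_one, trace_smul, smul_eq_mul, hQQ, Complex.sub_re, Complex.re_ofReal_mul] at h2 h3
    have h4 : (trace (M j * Q)).re ≤ c / t := by
      rw [le_div_iff₀ ht]
      linarith [hJ j hj]
    have h5 := mul_le_mul_of_nonneg_left h4 (hBtr (f j))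
    linarith
  have hterm : ∀ j ∈ J, (trace (M j * R)).re ≤ 2 * ((trace (B (f j))).re * (c / t))
      + 2 * ∑ i, (trace (M j * ((1 - Q) * B i * (1 - Q)))).re := by
    intro j hj
    rw [hMB]
    have h1 := trace_mul_re_le_two_mul_pinched (hM.herm j) (hM.idem j) hQ (hBpos (f j))
    have h2 := hfirst j hj
    have h3 := Finset.single_le_sum (fun i _ => hsecond i j) (Finset.mem_univ (f j))
    linarith
  refine (Finset.sum_le_sum hterm).trans ?_
  refine (Finset.sum_le_sum_of_subset_of_nonneg (Finset.subset_univ J) fun j _ _ => ?_).trans ?_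
  · have := Finset.sum_nonneg fun i (_ : i ∈ Finset.univ) => hsecond i j
    have := hBtr (f j)
    positivity
  rw [Finset.sum_add_distrib, ← Finset.mul_sum, ← Finset.mul_sum, add_comm]
  gcongr
  · have : ∀ j, ∑ i, (trace (M j * ((1 - Q) * B i * (1 - Q)))).re
        = (trace (M j * ((1 - Q) * R * (1 - Q)))).re := fun j => by
      rw [← Complex.re_sum, ← trace_sum, ← Finset.mul_sum, ← Finset.sum_mul, ← Finset.mul_sum,
        hBsum]
    simp only [this]
    rw [hM.sum_trace_mul_re, trace_mul_comm, ← Matrix.mul_assoc]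
    have : (1 - Q) * (1 - Q) = 1 - Q := by
      rw [sub_mul, mul_sub, mul_sub, hQQ]; simp
    rw [this]
  · have : ∑ j, (trace (B (f j))).re * (c / t)
        = ∑ i, (Finset.univ.filter (fun j => f j = i)).card * ((trace (B i)).re * (c / t)) := by
      rw [← Finset.sum_fiberwise Finset.univ f]
      refine Finset.sum_congr rfl fun i _ => ?_
      rw [Finset.sum_congr rfl fun j hj => by rw [(Finset.mem_filter.1 hj).2], Finset.sum_const,
        nsmul_eq_mul]
    rw [this]
    have htot : ∑ i, (trace (B i)).re = 1 := by
      rw [← Complex.re_sum, ← trace_sum, hBsum, hR1, Complex.one_re]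
    calc _ ≤ ∑ i, (w : ℝ) * ((trace (B i)).re * (c / t)) := by
          refine Finset.sum_le_sum fun i _ => ?_
          have := hBtr i
          have := hcard i
          gcongr
      _ = _ := by rw [← Finset.mul_sum, ← Finset.sum_mul, htot, one_mul]

end Trace

section TensorPower

variable {k : ℕ}

theorem tensPow_mul (A B : Matrix (Fin k) (Fin k) ℂ) (n : ℕ) :
    tensPow (A * B) n = tensPow A n * tensPow B n := by
  ext x y
  simp only [tensPow, Matrix.mul_apply, Fintype.prod_sum, Finset.prod_mul_distrib]

theorem tensPow_conjTranspose (A : Matrix (Fin k) (Fin k) ℂ) (n : ℕ) :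
    tensPow Aᴴ n = (tensPow A n)ᴴ := by
  ext x y
  simp [tensPow, conjTranspose_apply]

theorem tensPow_diagonal (v : Fin k → ℂ) (n : ℕ) :
    tensPow (diagonal v) n = diagonal fun x => ∏ i, v (x i) := by
  ext x y
  by_cases h : x = y
  · subst h; simp [tensPow]
  · obtain ⟨i, hi⟩ := Function.ne_iff.1 h
    rw [diagonal_apply_ne _ h]
    exact Finset.prod_eq_zero (Finset.mem_univ i) (diagonal_apply_ne _ hi)

theorem tensPow_one (n : ℕ) : tensPow (1 : Matrix (Fin k) (Fin k) ℂ) n = 1 := by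
  rw [← diagonal_one, tensPow_diagonal]
  simp

theorem trace_tensPow (A : Matrix (Fin k) (Fin k) ℂ) (n : ℕ) :
    trace (tensPow A n) = trace A ^ n := by
  have h := Fintype.prod_sum (fun (_ : Fin n) (a : Fin k) => A a a)
  rw [Finset.prod_const, Finset.card_univ, Fintype.card_fin] at h
  exact h.symm

/-- A Hermitian matrix and its logarithm are diagonalised by a common unitary. -/
theorem exists_unitary_diagonalization {d : Type*} [Fintype d] [DecidableEq d]
    {A : Matrix d d ℂ} (hA : A.IsHermitian) :
    ∃ U : Matrix d d ℂ, U * Uᴴ = 1 ∧ Uᴴ * U = 1 ∧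
      A = U * diagonal (fun i => (hA.eigenvalues i : ℂ)) * Uᴴ ∧
      matLog A = U * diagonal (fun i => ((Real.log (hA.eigenvalues i) : ℝ) : ℂ)) * Uᴴ := by
  refine ⟨hA.eigenvectorUnitary, Unitary.coe_mul_star_self _, Unitary.coe_star_mul_self _, ?_, ?_⟩
  · conv_lhs => rw [hA.spectral_theorem]
    rfl
  · rw [matLog, matFun, dif_pos hA]
    rfl

theorem conjTranspose_mul_mul_eq_of_eq_mul_mul {d : Type*} [Fintype d] [DecidableEq d]
    {A B U : Matrix d d ℂ} (hU : Uᴴ * U = 1) (h : A = U * B * Uᴴ) : Uᴴ * A * U = B := by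
  rw [h]
  simp only [Matrix.mul_assoc, hU, Matrix.mul_one]
  rw [← Matrix.mul_assoc, hU, Matrix.one_mul]

theorem trace_conj_diagonal {d : Type*} [Fintype d] [DecidableEq d] (A U : Matrix d d ℂ)
    (v : d → ℂ) : trace (A * (U * diagonal v * Uᴴ)) = ∑ x, (Uᴴ * A * U) x x * v x := by
  rw [← Matrix.mul_assoc, trace_mul_comm, ← Matrix.mul_assoc, ← Matrix.mul_assoc, trace]
  simp [Matrix.mul_diagonal]

theorem posSemidef_tensPow {A : Matrix (Fin k) (Fin k) ℂ} (hA : A.PosSemidef) (n : ℕ) :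
    (tensPow A n).PosSemidef := by
  obtain ⟨U, -, -, hAU, -⟩ := exists_unitary_diagonalization hA.1
  rw [hAU, tensPow_mul, tensPow_mul, tensPow_conjTranspose, tensPow_diagonal]
  refine (PosSemidef.diagonal fun x => ?_).mul_mul_conjTranspose_same _
  exact Finset.prod_nonneg fun i _ => Complex.zero_le_real.2 (hA.eigenvalues_nonneg _)

theorem posDef_tensPow {A : Matrix (Fin k) (Fin k) ℂ} (hA : A.PosDef) (n : ℕ) :
    (tensPow A n).PosDef := by
  refine (posSemidef_tensPow hA.posSemidef n).posDef_iff_isUnit.2 ?_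
  have hdet : IsUnit A.det := (Matrix.isUnit_iff_isUnit_det A).1 hA.isUnit
  refine IsUnit.of_mul_eq_one (tensPow A⁻¹ n) ?_
  rw [← tensPow_mul, Matrix.mul_nonsing_inv _ hdet, tensPow_one]

theorem IsPVM.trace_mul_re_pos {d κ : Type*} [Fintype d] [DecidableEq d] [Fintype κ]
    {M : κ → Matrix d d ℂ} (hM : IsPVM M) {S : Matrix d d ℂ} (hS : S.PosDef) (j : κ) :
    0 < (trace (M j * S)).re := by
  refine lt_of_le_of_ne
    (trace_proj_mul_re_nonneg (hM.herm j) (hM.idem j) hS.posSemidef) fun h => ?_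
  have hpos := hS.posSemidef.conjTranspose_mul_mul_same (M j)
  have h1 : trace (M j * S) = trace ((M j)ᴴ * S * M j) := by
    rw [(hM.herm j).eq, Matrix.mul_assoc, trace_mul_comm (M j) (S * M j), Matrix.mul_assoc,
      hM.idem, trace_mul_comm]
  have h0 : trace ((M j)ᴴ * S * M j) = 0 :=
    Complex.ext (by rw [← h1, ← h, Complex.zero_re])
      (Complex.le_def.1 hpos.trace_nonneg).2.symm
  rw [hpos.trace_eq_zero_iff] at h0
  refine hM.ne_zero j ?_
  by_contra hne
  obtain ⟨v, hv⟩ : ∃ v, M j *ᵥ v ≠ 0 := by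
    by_contra hall
    push Not at hall
    exact hne (Matrix.ext_of_mulVec_single fun i => by rw [hall, zero_mulVec])
  have := hS.dotProduct_mulVec_pos hv
  have h2 : star (M j *ᵥ v) ⬝ᵥ S *ᵥ (M j *ᵥ v) = star v ⬝ᵥ (((M j)ᴴ * S * M j) *ᵥ v) := by
    rw [star_mulVec, ← dotProduct_mulVec, mulVec_mulVec, mulVec_mulVec, Matrix.mul_assoc]
  rw [h2, h0] at this
  simp at this

/-- The distribution of `ρ` in the basis `U`. -/
theorem diag_conj_weights {ρ U : Matrix (Fin k) (Fin k) ℂ} (hρ : ρ.PosSemidef)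
    (hρ1 : ρ.trace = 1) (hU : U * Uᴴ = 1) :
    ∃ p : Fin k → ℝ, (∀ l, (Uᴴ * ρ * U) l l = p l) ∧ (∀ l, 0 ≤ p l) ∧ ∑ l, p l = 1 := by
  have hpos := hρ.conjTranspose_mul_mul_same U
  have hd : ∀ l, 0 ≤ (Uᴴ * ρ * U) l l := fun l => hpos.diag_nonneg
  have hre : ∀ l, (Uᴴ * ρ * U) l l = (((Uᴴ * ρ * U) l l).re : ℂ) := fun l =>
    Complex.ext (by simp) (by simpa using (Complex.le_def.1 (hd l)).2.symm)
  refine ⟨fun l => ((Uᴴ * ρ * U) l l).re, hre, fun l => (Complex.le_def.1 (hd l)).1, ?_⟩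
  rw [← Complex.re_sum]
  change (trace (Uᴴ * ρ * U)).re = 1
  rw [trace_mul_comm, ← Matrix.mul_assoc, hU, one_mul, hρ1, Complex.one_re]

theorem prod_eq_exp_sum_log {p s : Fin k → ℝ} (hs : ∀ l, 0 ≤ s l) (hps : ∀ l, s l = 0 → p l = 0)
    {n : ℕ} {x : Fin n → Fin k} (hx : ∏ i, p (x i) ≠ 0) :
    ∏ i, s (x i) = Real.exp (∑ i, Real.log (s (x i))) := by
  rw [Real.exp_sum]
  refine Finset.prod_congr rfl fun i _ => (Real.exp_log ?_).symm
  refine lt_of_le_of_ne (hs _) fun h => ?_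
  exact Finset.prod_ne_zero_iff.1 hx i (Finset.mem_univ i) (hps _ h.symm)

theorem sum_filter_not_typical (p g : Fin k → ℝ) (n : ℕ) (m δ : ℝ) :
    ∑ x : Fin n → Fin k, (∏ i, p (x i)) *
        (if |∑ i, g (x i) - n * m| ≤ n * δ ∧ ∏ i, p (x i) ≠ 0 then 0 else 1)
      = ∑ x ∈ Finset.univ.filter (fun x : Fin n → Fin k => n * δ < |∑ i, g (x i) - n * m|),
        ∏ i, p (x i) := by
  rw [Finset.sum_filter]
  refine Finset.sum_congr rfl fun x _ => ?_
  by_cases h0 : ∏ i, p (x i) = 0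
  · simp [h0]
  · by_cases h1 : |∑ i, g (x i) - n * m| ≤ n * δ
    · simp [h0, h1]
    · simp [h1, not_le.1 h1]

variable {ιE ιM : ℕ → Type} [∀ n, Fintype (ιE n)] [∀ n, Fintype (ιM n)]

/-- Outcomes whose `σ^{⊗n}`-likelihood is exponentially below `e^{n Tr ρ log σ}` are
asymptotically `ρ^{⊗n}`-negligible. -/
theorem tendsto_sum_small_likelihood {ρ σ : Matrix (Fin k) (Fin k) ℂ}
    (hρ : ρ.PosSemidef) (hρ1 : ρ.trace = 1)
    {E : ∀ n : ℕ, ιE n → Matrix (Fin n → Fin k) (Fin n → Fin k) ℂ}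
    {M : ∀ n : ℕ, ιM n → Matrix (Fin n → Fin k) (Fin n → Fin k) ℂ}
    (hE : ∀ n, IsPVM (E n)) (hEρ : ∀ n i, E n i * tensPow ρ n = tensPow ρ n * E n i)
    (hew : ∀ n, pvmWidth (E n) ≤ (n + 1) ^ (k - 1))
    (hM : ∀ n, IsPVM (M n)) (hMrank : ∀ n, pvmWidth (M n) = 1)
    (hRef : ∀ n, Refines (M n) (E n)) {U : Matrix (Fin k) (Fin k) ℂ} (hU : U * Uᴴ = 1)
    (hU' : Uᴴ * U = 1) {s : Fin k → ℝ} (hs : ∀ l, 0 ≤ s l)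
    (hσU : σ = U * diagonal (fun l => (s l : ℂ)) * Uᴴ)
    (hlogU : matLog σ = U * diagonal (fun l => ((Real.log (s l) : ℝ) : ℂ)) * Uᴴ)
    (hsρ : ∀ l, s l = 0 → (Uᴴ * ρ * U) l l = 0) {ε : ℝ} (hε : 0 < ε) :
    Tendsto (fun n : ℕ => ∑ j ∈ Finset.univ.filter (fun j : ιM n =>
        (trace (M n j * tensPow σ n)).re ≤ Real.exp (n * ((trace (ρ * matLog σ)).re - ε))),
      (trace (M n j * tensPow ρ n)).re) atTop (nhds 0) := by
  obtain ⟨p, hp, hp0, hp1⟩ := diag_conj_weights hρ hρ1 hU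
  set g : Fin k → ℝ := fun l => Real.log (s l) with hg
  have hm : (trace (ρ * matLog σ)).re = ∑ l, p l * g l := by
    rw [hlogU, trace_conj_diagonal, Complex.re_sum]
    simp only [hp, ← Complex.ofReal_mul, Complex.ofReal_re, hg]
  set m := ∑ l, p l * g l with hmdef
  rw [hm]
  have hps : ∀ l, s l = 0 → p l = 0 := fun l hl => by
    have := hsρ l hl
    rw [hp] at this
    exact_mod_cast this
  set δ := ε / 2 with hδ
  have hδ0 : 0 < δ := by positivity
  have hpoly : Tendsto (fun n : ℕ => ((n : ℝ) + 1) ^ (k - 1) * Real.exp (-(n * δ)))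
      atTop (nhds 0) := by
    have h1 := (Real.tendsto_pow_mul_exp_neg_atTop_nhds_zero (k - 1)).comp
      ((tendsto_atTop_add_const_right atTop (1 : ℝ) tendsto_natCast_atTop_atTop).atTop_mul_const
        hδ0)
    have h2 := h1.const_mul (Real.exp δ / δ ^ (k - 1))
    rw [mul_zero] at h2
    refine h2.congr fun n => ?_
    simp only [Function.comp]
    rw [show -(((n : ℝ) + 1) * δ) = -(n * δ) + -δ by ring, Real.exp_add, mul_pow, Real.exp_neg δ]
    field_simp
  have hlim := ((tendsto_sum_prod_filter_deviation hp0 hp1 g hδ0).const_mul 2).add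
    (hpoly.const_mul 2)
  simp only [mul_zero, add_zero] at hlim
  refine tendsto_of_tendsto_of_tendsto_of_le_of_le tendsto_const_nhds hlim
    (fun n => Finset.sum_nonneg fun j _ => trace_proj_mul_re_nonneg ((hM n).herm j)
      ((hM n).idem j) (posSemidef_tensPow hρ n)) fun n => ?_
  set V := tensPow U n with hV
  have hVV : V * Vᴴ = 1 := by rw [hV, ← tensPow_conjTranspose, ← tensPow_mul, hU, tensPow_one]
  have hVV' : Vᴴ * V = 1 := by rw [hV, ← tensPow_conjTranspose, ← tensPow_mul, hU', tensPow_one]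
  have hVρ : ∀ x, (Vᴴ * tensPow ρ n * V) x x = ((∏ i, p (x i) : ℝ) : ℂ) := fun x => by
    rw [hV, ← tensPow_conjTranspose, ← tensPow_mul, ← tensPow_mul, tensPow]
    simp [hp]
  have hVσ : tensPow σ n = V * diagonal (fun x => ((∏ i, s (x i) : ℝ) : ℂ)) * Vᴴ := by
    rw [hσU, tensPow_mul, tensPow_mul, tensPow_conjTranspose, tensPow_diagonal]
    simp [hV]
  let b : (Fin n → Fin k) → ℝ := fun x =>
    if |∑ i, g (x i) - n * m| ≤ n * δ ∧ ∏ i, p (x i) ≠ 0 then 0 else 1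
  set Q := V * diagonal (fun x => ((1 - b x : ℝ) : ℂ)) * Vᴴ with hQdef
  have hQ : Q.IsHermitian := by
    refine isHermitian_mul_mul_conjTranspose V (isHermitian_diagonal_of_self_adjoint _ ?_)
    ext x
    simp
  have hQQ : Q * Q = Q := by
    calc Q * Q = V * diagonal (fun x => ((1 - b x : ℝ) : ℂ)) * (Vᴴ * V)
          * diagonal (fun x => ((1 - b x : ℝ) : ℂ)) * Vᴴ := by
          simp only [hQdef, Matrix.mul_assoc]
      _ = Q := by
        rw [hVV', Matrix.mul_one, Matrix.mul_assoc V, diagonal_mul_diagonal, hQdef]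
        congr 3
        ext x
        simp only [b]
        split_ifs <;> simp
  have h1Q : 1 - Q = V * diagonal (fun x => (b x : ℂ)) * Vᴴ := by
    have : diagonal (fun x => ((1 - b x : ℝ) : ℂ)) = 1 - diagonal (fun x => (b x : ℂ)) := by
      rw [← diagonal_one, diagonal_sub]
      simp
    rw [hQdef, this, Matrix.mul_sub, Matrix.sub_mul, Matrix.mul_one, hVV]
    simp
  have htr : (trace ((1 - Q) * tensPow ρ n)).re = ∑ x, (∏ i, p (x i)) * b x := by
    rw [trace_mul_comm, h1Q, trace_conj_diagonal, Complex.re_sum]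
    simp only [hVρ, ← Complex.ofReal_mul, Complex.ofReal_re]
  have hS : (tensPow σ n - ((Real.exp (n * (m - δ)) : ℝ) : ℂ) • Q).PosSemidef := by
    have : tensPow σ n - ((Real.exp (n * (m - δ)) : ℝ) : ℂ) • Q = V * diagonal
        (fun x => ((∏ i, s (x i) - Real.exp (n * (m - δ)) * (1 - b x) : ℝ) : ℂ)) * Vᴴ := by
      rw [hVσ, hQdef, ← Matrix.smul_mul, ← Matrix.mul_smul, ← diagonal_smul, ← Matrix.sub_mul,
        ← Matrix.mul_sub, diagonal_sub]
      congr 3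
      ext x
      simp
    rw [this]
    refine (PosSemidef.diagonal fun x => ?_).mul_mul_conjTranspose_same V
    simp only [Pi.zero_apply]
    rw [Complex.zero_le_real]
    have hs0 : 0 ≤ ∏ i, s (x i) := Finset.prod_nonneg fun i _ => hs _
    simp only [b]
    split_ifs with c
    · rw [sub_zero, mul_one, sub_nonneg, prod_eq_exp_sum_log hs hps c.2, Real.exp_le_exp]
      have := (abs_le.1 c.1).1
      simp only [hg] at this
      linarith
    · simpa using hs0
  have hmain := (hM n).sum_filter_small_le (hMrank n) (hE n) (hRef n) (hew n) (hEρ n)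
    (posSemidef_tensPow hρ n) (by rw [trace_tensPow, hρ1, one_pow]) hQ hQQ (Real.exp_pos _)
    (Real.exp_pos (n * (m - ε))).le hS (J := Finset.univ.filter (fun j : ιM n =>
        (trace (M n j * tensPow σ n)).re ≤ Real.exp (n * (m - ε))))
    fun j hj => (Finset.mem_filter.1 hj).2
  refine hmain.trans (le_of_eq ?_)
  rw [htr, ← Real.exp_sub]
  simp only [b]
  rw [sum_filter_not_typical]
  push_cast
  congr 5
  rw [hδ]; ring

/-- Outcomes whose `ρ^{⊗n}`-likelihood is exponentially above `e^{n Tr ρ log ρ}` are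
asymptotically `ρ^{⊗n}`-negligible. -/
theorem tendsto_sum_large_likelihood {ρ : Matrix (Fin k) (Fin k) ℂ}
    (hρ : ρ.PosSemidef) (hρ1 : ρ.trace = 1)
    {M : ∀ n : ℕ, ιM n → Matrix (Fin n → Fin k) (Fin n → Fin k) ℂ}
    (hM : ∀ n, IsPVM (M n)) (hMrank : ∀ n, pvmWidth (M n) = 1) {ε : ℝ} (hε : 0 < ε) :
    Tendsto (fun n : ℕ => ∑ j ∈ Finset.univ.filter (fun j : ιM n =>
        Real.exp (n * ((trace (ρ * matLog ρ)).re + ε)) ≤ (trace (M n j * tensPow ρ n)).re),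
      (trace (M n j * tensPow ρ n)).re) atTop (nhds 0) := by
  obtain ⟨U, hU, hU', hρU, hlogU⟩ := exists_unitary_diagonalization hρ.1
  set r := hρ.1.eigenvalues with hr
  have hr0 : ∀ l, 0 ≤ r l := hρ.eigenvalues_nonneg
  have hdiag := conjTranspose_mul_mul_eq_of_eq_mul_mul hU' hρU
  have hr1 : ∑ l, r l = 1 := by
    have h := congrArg Complex.re hρ.1.trace_eq_sum_eigenvalues
    rw [hρ1, Complex.re_sum] at h
    simpa using h.symm
  set g : Fin k → ℝ := fun l => Real.log (r l) with hg
  have hm : (trace (ρ * matLog ρ)).re = ∑ l, r l * g l := by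
    rw [hlogU, trace_conj_diagonal, Complex.re_sum]
    simp only [hdiag, diagonal_apply_eq, ← Complex.ofReal_mul, Complex.ofReal_re, hg]
  set m := ∑ l, r l * g l with hmdef
  rw [hm]
  set δ := ε / 2 with hδ
  have hδ0 : 0 < δ := by positivity
  have hlim := (tendsto_sum_prod_filter_deviation hr0 hr1 g hδ0).const_mul 2
  rw [mul_zero] at hlim
  refine tendsto_of_tendsto_of_tendsto_of_le_of_le' tendsto_const_nhds hlim
    (Eventually.of_forall fun n => Finset.sum_nonneg fun j _ =>
      trace_proj_mul_re_nonneg ((hM n).herm j) ((hM n).idem j) (posSemidef_tensPow hρ n)) ?_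
  filter_upwards [(tendsto_exp_neg_nat_mul hδ0).eventually_lt_const
    (show (0 : ℝ) < 1 / 2 by norm_num)] with n hn
  set V := tensPow U n with hV
  have hVV : V * Vᴴ = 1 := by rw [hV, ← tensPow_conjTranspose, ← tensPow_mul, hU, tensPow_one]
  have hVV' : Vᴴ * V = 1 := by rw [hV, ← tensPow_conjTranspose, ← tensPow_mul, hU', tensPow_one]
  have hVρ : tensPow ρ n = V * diagonal (fun x => ((∏ i, r (x i) : ℝ) : ℂ)) * Vᴴ := by
    conv_lhs => rw [hρU]
    rw [tensPow_mul, tensPow_mul, tensPow_conjTranspose, tensPow_diagonal]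
    simp [hV]
  let b : (Fin n → Fin k) → ℝ := fun x =>
    if |∑ i, g (x i) - n * m| ≤ n * δ ∧ ∏ i, r (x i) ≠ 0 then 0 else 1
  have hb : ∀ x, 0 ≤ b x := fun x => by simp only [b]; split_ifs <;> simp
  set A := V * diagonal (fun x => (((∏ i, r (x i)) * b x : ℝ) : ℂ)) * Vᴴ with hAdef
  have hA : A.PosSemidef := by
    refine (PosSemidef.diagonal fun x => ?_).mul_mul_conjTranspose_same V
    simp only [Pi.zero_apply]
    rw [Complex.zero_le_real]
    exact mul_nonneg (Finset.prod_nonneg fun i _ => hr0 _) (hb x)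
  have htr : (trace A).re = ∑ x, (∏ i, r (x i)) * b x := by
    rw [hAdef, trace_mul_comm, ← Matrix.mul_assoc, hVV', one_mul, trace_diagonal,
      Complex.re_sum]
    simp only [Complex.ofReal_re]
  have hAu : (((Real.exp (n * (m + δ)) : ℝ) : ℂ) • 1 - (tensPow ρ n - A)).PosSemidef := by
    have : ((Real.exp (n * (m + δ)) : ℝ) : ℂ) • 1 - (tensPow ρ n - A) = V * diagonal
        (fun x => ((Real.exp (n * (m + δ)) - (∏ i, r (x i)) * (1 - b x) : ℝ) : ℂ)) * Vᴴ := by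
      rw [← hVV, hVρ, hAdef, ← Matrix.smul_mul, ← Matrix.sub_mul, ← Matrix.sub_mul,
        ← Matrix.mul_sub, diagonal_sub]
      congr 1
      nth_rewrite 1 [← Matrix.mul_one V]
      rw [← Matrix.mul_smul, ← Matrix.mul_sub, ← diagonal_one, ← diagonal_smul, diagonal_sub]
      congr 2
      ext x
      simp
      ring
    rw [this]
    refine (PosSemidef.diagonal fun x => ?_).mul_mul_conjTranspose_same V
    simp only [Pi.zero_apply]
    rw [Complex.zero_le_real]
    simp only [b]
    split_ifs with c
    · rw [sub_zero, mul_one, sub_nonneg, prod_eq_exp_sum_log hr0 (fun _ => id) c.2,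
        Real.exp_le_exp]
      have := (abs_le.1 c.1).2
      simp only [hg] at this
      linarith
    · simpa using (Real.exp_pos _).le
  have hmain := (hM n).sum_filter_large_le (hMrank n) hA hAu
    (J := Finset.univ.filter (fun j : ιM n =>
        Real.exp (n * (m + ε)) ≤ (trace (M n j * tensPow ρ n)).re)) fun j hj => by
      refine le_trans ?_ (Finset.mem_filter.1 hj).2
      have h1 : Real.exp (n * (m + δ)) = Real.exp (-(n * δ)) * Real.exp (n * (m + ε)) := by
        rw [← Real.exp_add]; congr 1; rw [hδ]; ring
      rw [h1]
      have := Real.exp_pos (n * (m + ε))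
      nlinarith
  refine hmain.trans (le_of_eq ?_)
  rw [htr]
  simp only [b]
  rw [sum_filter_not_typical]

end TensorPower

/-- **Characterization of optimal measurement sequences (Theorem 2).**
Given PVMs `E n` commuting with `ρ^{⊗n}` and `σ^{⊗n}` with `w(E n) ≤ (n+1)^(k-1)` and
rank-one PVMs `M n` refining `E n`, the measurement sequence attains
`B^{M⃗}(ρ‖σ) = D(ρ‖σ)` iff `-(1/n) log P_{σ^{⊗n}}^{M^n}` converges to `-Tr ρ log σ`
in probability w.r.t. `P_{ρ^{⊗n}}^{M^n}`. -/
theorem stmt_3 (k : ℕ) (ρ σ : Matrix (Fin k) (Fin k) ℂ)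
    (hρ : ρ.PosSemidef) (hρ1 : ρ.trace = 1)
    (hσ : σ.PosDef) (hσ1 : σ.trace = 1)
    (ιE ιM : ℕ → Type) [∀ n, Fintype (ιE n)] [∀ n, Fintype (ιM n)]
    (E : ∀ n : ℕ, ιE n → Matrix (Fin n → Fin k) (Fin n → Fin k) ℂ)
    (M : ∀ n : ℕ, ιM n → Matrix (Fin n → Fin k) (Fin n → Fin k) ℂ)
    (hE : ∀ n, IsPVM (E n))
    (hEρ : ∀ n i, E n i * tensPow ρ n = tensPow ρ n * E n i)
    (hEσ : ∀ n i, E n i * tensPow σ n = tensPow σ n * E n i)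
    (hew : ∀ n, pvmWidth (E n) ≤ (n + 1) ^ (k - 1))
    (hM : ∀ n, IsPVM (M n))
    (hMrank : ∀ n, pvmWidth (M n) = 1)
    (hRef : ∀ n, Refines (M n) (E n)) :
    (sSup {lam : ℝ | ∃ T : ∀ n : ℕ, ιM n → ℝ,
        (∀ n i, T n i ∈ Set.Icc (0 : ℝ) 1) ∧
        Filter.Tendsto
          (fun n : ℕ => ∑ i, (1 - T n i) * (Matrix.trace (M n i * tensPow ρ n)).re)
          Filter.atTop (nhds 0) ∧
        Filter.limsup
          (fun n : ℕ => (1 / (n : ℝ)) *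
            Real.log (∑ i, T n i * (Matrix.trace (M n i * tensPow σ n)).re))
          Filter.atTop ≤ -lam}
      = qRelEnt ρ σ)
    ↔ (∀ ε > (0 : ℝ), Filter.Tendsto
        (fun n : ℕ => ∑ i ∈ Finset.univ.filter (fun i : ιM n =>
            ε < |(-(1 / (n : ℝ)) * Real.log (Matrix.trace (M n i * tensPow σ n)).re)
              - (-(Matrix.trace (ρ * matLog σ)).re)|),
          (Matrix.trace (M n i * tensPow ρ n)).re)
        Filter.atTop (nhds 0)) := by
  have hρn : ∀ n, (tensPow ρ n).PosSemidef := posSemidef_tensPow hρ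
  have hD : qRelEnt ρ σ = (trace (ρ * matLog ρ)).re - (trace (ρ * matLog σ)).re := by
    rw [qRelEnt, Matrix.mul_sub, trace_sub, Complex.sub_re]
  obtain ⟨U, hU, hU', hσU, hlogU⟩ := exists_unitary_diagonalization hσ.1
  obtain ⟨V, hV, hV', hρV, hlogV⟩ := exists_unitary_diagonalization hρ.1
  rw [hD]
  refine sSup_exponent_eq_iff_tendsto
    (P := fun n j => (trace (M n j * tensPow ρ n)).re)
    (Q := fun n j => (trace (M n j * tensPow σ n)).re)
    (fun n j => trace_proj_mul_re_nonneg ((hM n).herm j) ((hM n).idem j) (hρn n))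
    (fun n => by simp [(hM n).sum_trace_mul_re, trace_tensPow, hρ1])
    (fun n j => (hM n).trace_mul_re_pos (posDef_tensPow hσ n) j)
    (fun n => by simp [(hM n).sum_trace_mul_re, trace_tensPow, hσ1])
    (fun ε hε => ?_)
    (fun ε hε => tendsto_sum_large_likelihood hρ hρ1 hM hMrank hε)
    (fun ε hε => ?_)
  · refine tendsto_sum_small_likelihood hρ hρ1 hE hEρ hew hM hMrank hRef hV hV'
      hρ.eigenvalues_nonneg hρV hlogV (fun l hl => ?_) hε
    rw [conjTranspose_mul_mul_eq_of_eq_mul_mul hV' hρV, diagonal_apply_eq, hl, Complex.ofReal_zero]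
  · exact tendsto_sum_small_likelihood hρ hρ1 hE hEρ hew hM hMrank hRef hU hU'
      (fun l => (hσ.eigenvalues_pos l).le) hσU hlogU
      (fun l hl => absurd hl (hσ.eigenvalues_pos l).ne') hε
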